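/- For all x > 0 and 0 < b < a, the integral over t in (0, ∞) of sin(a t)·cos(b t) / (t · (x² + t²)) dt equals (π / (2x²)) · (1 − e^{-a x} · cosh(b x)). -/

import Mathlib

open Real MeasureTheory Filter intervalIntegral

theorem integrable_inv_sq_add_sq {x : ℝ} (hx : 0 < x) :
    Integrable fun t : ℝ => (x ^ 2 + t ^ 2)⁻¹ := by
  have h := (integrable_inv_one_add_sq.comp_div hx.ne').const_mul (x ^ 2)⁻¹
  refine h.congr (Eventually.of_forall fun t => ?_)
  field_simp

theorem integrable_exp_neg_mul_abs {c : ℝ} (hc : 0 < c) :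
    Integrable fun v : ℝ => Real.exp (-c * |v|) := by
  rw [← integrableOn_univ, ← Set.Iic_union_Ioi (a := (0 : ℝ))]
  refine IntegrableOn.union ?_ ?_
  · refine (integrableOn_exp_mul_Iic hc 0).congr_fun (fun v hv => ?_) measurableSet_Iic
    simp only [abs_of_nonpos (Set.mem_Iic.1 hv), neg_mul_neg]
  · refine (exp_neg_integrableOn_Ioi 0 hc).congr_fun (fun v hv => ?_) measurableSet_Ioi
    simp only [abs_of_pos (Set.mem_Ioi.1 hv)]

open FourierTransform in
theorem fourier_exp_neg_two_pi_mul_abs {x : ℝ} (hx : 0 < x) (w : ℝ) :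
    𝓕 (fun v : ℝ => (Real.exp (-(2 * π * x) * |v|) : ℂ)) w =
      ((x / π * (x ^ 2 + w ^ 2)⁻¹ : ℝ) : ℂ) := by
  have hpi := Real.pi_pos
  have hint : Integrable fun v : ℝ =>
      Complex.exp (↑(-2 * π * v * w) * Complex.I) • (Real.exp (-(2 * π * x) * |v|) : ℂ) := by
    refine (integrable_exp_neg_mul_abs (by positivity : 0 < 2 * π * x)).ofReal.bdd_mul
      (c := 1) (by fun_prop) (Eventually.of_forall fun v => ?_)
    rw [Complex.norm_exp_ofReal_mul_I]
  rw [fourier_real_eq_integral_exp_smul, ← setIntegral_univ, ← Set.Iic_union_Ioi (a := (0 : ℝ)),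
    setIntegral_union (Set.Iic_disjoint_Ioi le_rfl) measurableSet_Ioi hint.integrableOn
      hint.integrableOn]
  have hneg : ∀ v ∈ Set.Iic (0 : ℝ), Complex.exp (↑(-2 * π * v * w) * Complex.I) •
      (Real.exp (-(2 * π * x) * |v|) : ℂ) =
        Complex.exp ((2 * π * (x - w * Complex.I)) * v) := by
    intro v hv
    rw [abs_of_nonpos hv, smul_eq_mul, Complex.ofReal_exp, ← Complex.exp_add]
    push_cast
    ring_nf
  have hpos : ∀ v ∈ Set.Ioi (0 : ℝ), Complex.exp (↑(-2 * π * v * w) * Complex.I) •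
      (Real.exp (-(2 * π * x) * |v|) : ℂ) =
        Complex.exp ((-(2 * π * (x + w * Complex.I))) * v) := by
    intro v hv
    rw [abs_of_pos hv, smul_eq_mul, Complex.ofReal_exp, ← Complex.exp_add]
    push_cast
    ring_nf
  rw [setIntegral_congr_fun measurableSet_Iic hneg, setIntegral_congr_fun measurableSet_Ioi hpos,
    integral_exp_mul_complex_Iic (by simpa using by positivity),
    integral_exp_mul_complex_Ioi (by simpa using by positivity)]
  have h1 : (x - w * Complex.I : ℂ) ≠ 0 := fun h => hx.ne' (by simpa using congrArg Complex.re h)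
  have h2 : (x + w * Complex.I : ℂ) ≠ 0 := fun h => hx.ne' (by simpa using congrArg Complex.re h)
  have h3 : (x ^ 2 + w ^ 2 : ℂ) = (x - w * Complex.I) * (x + w * Complex.I) := by
    linear_combination (w ^ 2 : ℂ) * Complex.I_sq
  have h4 : (π : ℂ) ≠ 0 := by exact_mod_cast hpi.ne'
  push_cast
  rw [h3]
  simp only [mul_zero, Complex.exp_zero]
  field_simp
  ring

open FourierTransform in
theorem integral_cos_mul_div_sq_add_sq {x : ℝ} (hx : 0 < x) {s : ℝ} (hs : 0 ≤ s) :
    ∫ t in Set.Ioi (0 : ℝ), Real.cos (s * t) * (x ^ 2 + t ^ 2)⁻¹ =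
      π / (2 * x) * Real.exp (-x * s) := by
  have hpi := Real.pi_pos
  have hF := funext (fourier_exp_neg_two_pi_mul_abs hx)
  have hinv := MeasureTheory.Integrable.fourierInv_fourier_eq (v := s / (2 * π))
    (integrable_exp_neg_mul_abs (by positivity : 0 < 2 * π * x)).ofReal
    (by
      refine Integrable.congr ?_ (Eventually.of_forall fun w => (congrFun hF w).symm)
      exact ((integrable_inv_sq_add_sq hx).const_mul _).ofReal)
    (by fun_prop)
  erw [hF] at hinv
  rw [Real.fourierInv_eq'] at hinv
  have hre := congrArg Complex.re hinv
  have hint : Integrable fun w : ℝ => Complex.exp (↑(2 * π * inner ℝ w (s / (2 * π))) * Complex.I) •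
      ((x / π * (x ^ 2 + w ^ 2)⁻¹ : ℝ) : ℂ) := by
    refine ((integrable_inv_sq_add_sq hx).const_mul _).ofReal.bdd_mul
      (c := 1) (by fun_prop) (Eventually.of_forall fun v => ?_)
    rw [Complex.norm_exp_ofReal_mul_I]
  rw [← RCLike.re_to_complex, ← integral_re hint] at hre
  have hpt : ∀ w : ℝ, RCLike.re (Complex.exp (↑(2 * π * inner ℝ w (s / (2 * π))) * Complex.I) •
      ((x / π * (x ^ 2 + w ^ 2)⁻¹ : ℝ) : ℂ)) =
        x / π * (Real.cos (s * |w|) * (x ^ 2 + |w| ^ 2)⁻¹) := by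
    intro w
    have h1 : 2 * π * inner ℝ w (s / (2 * π)) = s * w := by
      simp
      field_simp
    have h2 : Real.cos (s * |w|) = Real.cos (s * w) := by
      rw [← Real.cos_abs (s * w), abs_mul, abs_of_nonneg hs]
    rw [h1, h2, sq_abs, smul_eq_mul, RCLike.re_to_complex, Complex.re_mul_ofReal,
      Complex.exp_ofReal_mul_I_re]
    ring
  simp_rw [hpt] at hre
  rw [MeasureTheory.integral_const_mul,
    integral_comp_abs (f := fun w => Real.cos (s * w) * (x ^ 2 + w ^ 2)⁻¹)] at hre
  have h5 : -(2 * π * x) * |s / (2 * π)| = -x * s := by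
    rw [abs_of_nonneg (by positivity)]
    field_simp
  rw [Complex.ofReal_re, h5] at hre
  rw [← hre]
  field_simp

theorem integral_cos_mul_right (c : ℝ) {t : ℝ} (ht : t ≠ 0) :
    ∫ s in (0 : ℝ)..c, Real.cos (s * t) = Real.sin (c * t) / t := by
  rw [intervalIntegral.integral_comp_mul_right _ ht, integral_cos]
  simp [div_eq_inv_mul]

theorem integrableOn_sin_div_mul_sq_add_sq {x : ℝ} (hx : 0 < x) (c : ℝ) :
    IntegrableOn (fun t => Real.sin (c * t) / (t * (x ^ 2 + t ^ 2))) (Set.Ioi 0) := by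
  have h : Integrable (fun t : ℝ => Real.sin (c * t) / t * (x ^ 2 + t ^ 2)⁻¹) := by
    refine (integrable_inv_sq_add_sq hx).bdd_mul (c := |c|)
      (Measurable.aestronglyMeasurable (by fun_prop)) (Eventually.of_forall fun t => ?_)
    rw [norm_div, Real.norm_eq_abs, Real.norm_eq_abs]
    refine div_le_of_le_mul₀ (abs_nonneg _) (abs_nonneg _) ?_
    rw [← abs_mul]
    exact Real.abs_sin_le_abs
  refine h.integrableOn.congr_fun (fun t _ => ?_) measurableSet_Ioi
  simp only [div_eq_mul_inv, mul_inv, mul_assoc]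

theorem integral_sin_div_mul_sq_add_sq {x : ℝ} (hx : 0 < x) {c : ℝ} (hc : 0 ≤ c) :
    ∫ t in Set.Ioi (0 : ℝ), Real.sin (c * t) / (t * (x ^ 2 + t ^ 2)) =
      π / (2 * x ^ 2) * (1 - Real.exp (-x * c)) := by
  have hfin : IsFiniteMeasure (volume.restrict (Set.uIoc 0 c)) :=
    isFiniteMeasure_restrict.2 (by simp [Set.uIoc])
  have hprod : Integrable
      (Function.uncurry fun s t : ℝ => Real.cos (s * t) * (x ^ 2 + t ^ 2)⁻¹)
      ((volume.restrict (Set.uIoc 0 c)).prod (volume.restrict (Set.Ioi 0))) := by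
    refine (((integrable_inv_sq_add_sq hx).integrableOn (s := Set.Ioi 0)).comp_snd
      (volume.restrict (Set.uIoc 0 c))).bdd_mul (c := 1)
      (by fun_prop) (Eventually.of_forall fun p => ?_)
    exact Real.abs_cos_le_one _
  have hswap := intervalIntegral_integral_swap hprod
  have hl : ∫ s in (0 : ℝ)..c, ∫ t in Set.Ioi (0 : ℝ), Real.cos (s * t) * (x ^ 2 + t ^ 2)⁻¹ =
      ∫ s in (0 : ℝ)..c, π / (2 * x) * Real.exp (-x * s) := by
    refine intervalIntegral.integral_congr fun s hs => ?_
    rw [Set.uIcc_of_le hc] at hs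
    exact integral_cos_mul_div_sq_add_sq hx hs.1
  rw [hl] at hswap
  have hr : ∀ t ∈ Set.Ioi (0 : ℝ), ∫ s in (0 : ℝ)..c, Real.cos (s * t) * (x ^ 2 + t ^ 2)⁻¹ =
      Real.sin (c * t) / (t * (x ^ 2 + t ^ 2)) := by
    intro t ht
    rw [intervalIntegral.integral_mul_const, integral_cos_mul_right c (ne_of_gt ht)]
    simp only [div_eq_mul_inv, mul_inv, mul_assoc]
  rw [setIntegral_congr_fun measurableSet_Ioi hr] at hswap
  rw [← hswap, intervalIntegral.integral_const_mul,
    intervalIntegral.integral_comp_mul_left _ (neg_ne_zero.2 hx.ne'), integral_exp]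
  simp only [mul_zero, Real.exp_zero, smul_eq_mul]
  field_simp
  ring

theorem sin_cos_over_t_integral' (a b x : ℝ) (hx : 0 < x) (hb : 0 < b) (hba : b < a) :
    Tendsto (fun R : ℝ =>
        ∫ t in (0:ℝ)..R, Real.sin (a * t) * Real.cos (b * t) / (t * (x ^ 2 + t ^ 2)))
      atTop (nhds ((Real.pi / (2 * x ^ 2)) * (1 - Real.exp (-a * x) * Real.cosh (b * x)))) := by
  have hi₁ := integrableOn_sin_div_mul_sq_add_sq hx (a + b)
  have hi₂ := integrableOn_sin_div_mul_sq_add_sq hx (a - b)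
  have heq : (fun t => Real.sin (a * t) * Real.cos (b * t) / (t * (x ^ 2 + t ^ 2))) =
      fun t => 1 / 2 * (Real.sin ((a + b) * t) / (t * (x ^ 2 + t ^ 2)) +
        Real.sin ((a - b) * t) / (t * (x ^ 2 + t ^ 2))) := by
    funext t
    rw [add_mul, sub_mul, Real.sin_add, Real.sin_sub]
    ring
  rw [heq]
  convert! intervalIntegral_tendsto_integral_Ioi 0 ((hi₁.add hi₂).const_mul (1 / 2)) tendsto_id
    using 2
  simp only [Pi.add_apply]
  rw [MeasureTheory.integral_const_mul, MeasureTheory.integral_add hi₁ hi₂,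
    integral_sin_div_mul_sq_add_sq hx (by linarith),
    integral_sin_div_mul_sq_add_sq hx (by linarith), Real.cosh_eq,
    show -x * (a + b) = -a * x + -(b * x) by ring, show -x * (a - b) = -a * x + b * x by ring,
    Real.exp_add, Real.exp_add]
  ring
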